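/- The interior of the Tits cone equals the set of linear functionals that are strictly positive on all nonzero elements of the closed imaginary cone: T_R° = {Z ∈ (RΛ)*_R : Z(v) > 0 for all v ∈ I \ {0}}. -/

import Mathlib

noncomputable def coxEntry {B : Type*} (M : CoxeterMatrix B) (s t : B) : ℝ :=
  if M s t = 0 then -2 else -2 * Real.cos (Real.pi / (M s t))

noncomputable def coxForm {B : Type*} [Fintype B] (M : CoxeterMatrix B) (v w : B → ℝ) : ℝ :=
  ∑ s, ∑ t, v s * w t * coxEntry M s t

/-- The simple root `α_s` in `RΛ ≅ (B → ℝ)`. -/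
noncomputable def simpleRoot {B : Type*} [DecidableEq B] (s : B) : B → ℝ := Pi.single s 1

/-- The set of real roots: the `W`-orbit of the simple roots under the Tits representation. -/
def rootSet {B : Type*} [DecidableEq B] {W : Type*} [Group W]
    (ρ : W →* ((B → ℝ) ≃ₗ[ℝ] (B → ℝ))) : Set (B → ℝ) :=
  {v | ∃ (w : W) (s : B), v = ρ w (simpleRoot s)}

/-- The set of positive real roots. -/
def posRootSet {B : Type*} [DecidableEq B] {W : Type*} [Group W]
    (ρ : W →* ((B → ℝ) ≃ₗ[ℝ] (B → ℝ))) : Set (B → ℝ) :=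
  {v ∈ rootSet ρ | ∀ i, 0 ≤ v i}

/-- The set `K = {v ∈ ℝ_{≥0}Λ : B(v, α_s) ≤ 0 for all s}`. -/
noncomputable def coneK {B : Type*} [Fintype B] [DecidableEq B] (M : CoxeterMatrix B) :
    Set (B → ℝ) :=
  {v | (∀ i, 0 ≤ v i) ∧ ∀ s, coxForm M v (simpleRoot s) ≤ 0}

/-- The closed imaginary cone `I = closure (W · K)`. -/
noncomputable def imagCone {B : Type*} [Fintype B] [DecidableEq B] (M : CoxeterMatrix B)
    {W : Type*} [Group W] (ρ : W →* ((B → ℝ) ≃ₗ[ℝ] (B → ℝ))) : Set (B → ℝ) :=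
  closure {v | ∃ (w : W), ∃ k ∈ coneK M, v = ρ w k}


/-- The pairing between the dual space `(RΛ)*` (in coordinates: `z : B → ℝ`, with
`z i = Z(α_i)`) and `RΛ`. -/
def evalR {B : Type*} [Fintype B] (z : B → ℝ) (v : B → ℝ) : ℝ := ∑ i, v i * z i

/-- The Tits cone `T = W · C̄` in the dual space, written in coordinates. -/
def titsConeCoord {B : Type*} [Fintype B] [DecidableEq B] {W : Type*} [Group W]
    (ρ : W →* ((B → ℝ) ≃ₗ[ℝ] (B → ℝ))) : Set (B → ℝ) :=
  {z | ∃ w : W, ∀ s : B, 0 ≤ evalR z (ρ w (simpleRoot s))}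

set_option linter.unusedSectionVars false
set_option linter.unusedSimpArgs false

section TitsHelpers

variable {B : Type*} [Fintype B] [DecidableEq B] (M : CoxeterMatrix B)
  {W : Type*} [Group W]

theorem tc_entry_symm (s t : B) : coxEntry M s t = coxEntry M t s := by
  unfold coxEntry; rw [M.symmetric s t]

theorem tc_entry_diag (s : B) : coxEntry M s s = 2 := by
  simp [coxEntry]

theorem tc_two_le {s t : B} (h : s ≠ t) (h0 : M s t ≠ 0) : 2 ≤ M s t := by
  have := M.off_diagonal s t h
  have h1 : M s t ≠ 1 := this
  omega

theorem tc_entry_nonpos {s t : B} (h : s ≠ t) : coxEntry M s t ≤ 0 := by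
  unfold coxEntry
  split_ifs with h0
  · norm_num
  · have h2 := tc_two_le M h h0
    have h3 : (2:ℝ) ≤ (M s t : ℝ) := by exact_mod_cast h2
    have : 0 ≤ Real.cos (Real.pi / (M s t)) := by
      apply Real.cos_nonneg_of_neg_pi_div_two_le_of_le
      · have : 0 ≤ Real.pi / (M s t) := by positivity
        linarith [Real.pi_pos]
      · exact div_le_div_of_nonneg_left Real.pi_pos.le (by norm_num) h3
    linarith

theorem tc_symm (v w : B → ℝ) : coxForm M v w = coxForm M w v := by
  unfold coxForm
  rw [Finset.sum_comm]
  refine Finset.sum_congr rfl fun s _ => Finset.sum_congr rfl fun t _ => ?_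
  rw [tc_entry_symm M s t]; ring

theorem tc_add_left (u v w : B → ℝ) :
    coxForm M (u + v) w = coxForm M u w + coxForm M v w := by
  simp only [coxForm, ← Finset.sum_add_distrib, Pi.add_apply]
  refine Finset.sum_congr rfl fun s _ => Finset.sum_congr rfl fun t _ => ?_
  ring

theorem tc_smul_left (c : ℝ) (v w : B → ℝ) :
    coxForm M (c • v) w = c * coxForm M v w := by
  simp only [coxForm, Finset.mul_sum, Pi.smul_apply, smul_eq_mul]
  refine Finset.sum_congr rfl fun s _ => Finset.sum_congr rfl fun t _ => ?_
  ring

theorem tc_add_right (u v w : B → ℝ) :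
    coxForm M w (u + v) = coxForm M w u + coxForm M w v := by
  rw [tc_symm, tc_add_left, tc_symm M u, tc_symm M v]

theorem tc_smul_right (c : ℝ) (v w : B → ℝ) :
    coxForm M w (c • v) = c * coxForm M w v := by
  rw [tc_symm, tc_smul_left, tc_symm]

theorem tc_neg_right (v w : B → ℝ) : coxForm M w (-v) = - coxForm M w v := by
  have := tc_smul_right M (-1) v w
  simpa using this

theorem tc_sub_right (u v w : B → ℝ) :
    coxForm M w (u - v) = coxForm M w u - coxForm M w v := by
  rw [sub_eq_add_neg, tc_add_right, tc_neg_right]; ring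

theorem tc_sub_left (u v w : B → ℝ) :
    coxForm M (u - v) w = coxForm M u w - coxForm M v w := by
  rw [tc_symm, tc_sub_right, tc_symm M u, tc_symm M v]

theorem tc_simple_left (s : B) (v : B → ℝ) :
    coxForm M (simpleRoot s) v = ∑ t, v t * coxEntry M s t := by
  unfold coxForm simpleRoot
  rw [Finset.sum_eq_single s]
  · simp
  · intro b _ hb
    simp [Pi.single_eq_of_ne hb]
  · simp

theorem tc_simple_simple (s t : B) :
    coxForm M (simpleRoot s) (simpleRoot t) = coxEntry M s t := by
  rw [tc_simple_left, Finset.sum_eq_single t]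
  · simp [simpleRoot]
  · intro b _ hb
    simp [simpleRoot, Pi.single_eq_of_ne hb]
  · simp

theorem tc_expand (v w : B → ℝ) :
    coxForm M v w = ∑ s, v s * coxForm M (simpleRoot s) w := by
  simp only [tc_simple_left, Finset.mul_sum]
  unfold coxForm
  refine Finset.sum_congr rfl fun s _ => Finset.sum_congr rfl fun t _ => ?_
  ring

theorem tc_continuous {X : Type*} [TopologicalSpace X] {f g : X → (B → ℝ)}
    (hf : Continuous f) (hg : Continuous g) : Continuous fun x => coxForm M (f x) (g x) := by
  unfold coxForm
  fun_prop

variable {M} (cs : CoxeterSystem M W)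
    (ρ : W →* ((B → ℝ) ≃ₗ[ℝ] (B → ℝ)))

theorem tc_mul (a b : W) (v : B → ℝ) : ρ (a * b) v = ρ a (ρ b v) := by
  rw [map_mul]; rfl

theorem tc_one (v : B → ℝ) : ρ 1 v = v := by
  rw [map_one]; rfl

theorem tc_inv_apply (a : W) (v : B → ℝ) : ρ a (ρ a⁻¹ v) = v := by
  rw [← tc_mul, mul_inv_cancel, tc_one]

theorem tc_inv_apply' (a : W) (v : B → ℝ) : ρ a⁻¹ (ρ a v) = v := by
  rw [← tc_mul, inv_mul_cancel, tc_one]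

theorem tc_rho_continuous (a : W) : Continuous fun v => ρ a v :=
  LinearMap.continuous_of_finiteDimensional (ρ a).toLinearMap

theorem tc_simple_nonneg (s i : B) : 0 ≤ simpleRoot s i := by
  unfold simpleRoot
  by_cases h : i = s
  · subst h; simp
  · simp [Pi.single_eq_of_ne h]

theorem tc_refl_self (hρ : ∀ (s : B) (v : B → ℝ),
      ρ (cs.simple s) v = v - coxForm M (simpleRoot s) v • simpleRoot s)
    (s : B) : ρ (cs.simple s) (simpleRoot s) = - simpleRoot s := by
  rw [hρ, tc_simple_simple, tc_entry_diag]
  module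

theorem tc_invariant (hρ : ∀ (s : B) (v : B → ℝ),
      ρ (cs.simple s) v = v - coxForm M (simpleRoot s) v • simpleRoot s)
    (w : W) (u v : B → ℝ) :
    coxForm M (ρ w u) (ρ w v) = coxForm M u v := by
  refine cs.simple_induction_left (p := fun w => coxForm M (ρ w u) (ρ w v) = coxForm M u v) w ?_ ?_
  · simp [tc_one]
  · intro w i ih
    rw [tc_mul, tc_mul, hρ, hρ]
    simp only [tc_sub_right, tc_sub_left, tc_smul_left, tc_smul_right, tc_simple_simple,
      tc_entry_diag, ih]
    rw [tc_symm M (ρ w u) (simpleRoot i)]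
    ring

/-- Chebyshev-like sequence. -/
noncomputable def tcCheb (c : ℝ) : ℕ → ℝ
  | 0 => 0
  | 1 => 1
  | (n + 2) => - c * tcCheb c (n + 1) - tcCheb c n

theorem tc_cheb_infty (n : ℕ) : tcCheb (-2) n = n := by
  induction n using Nat.twoStepInduction with
  | zero => simp [tcCheb]
  | one => simp [tcCheb]
  | more n h1 h2 => rw [tcCheb, h1, h2]; push_cast; ring

theorem tc_cheb_sin (θ : ℝ) (n : ℕ) :
    tcCheb (-2 * Real.cos θ) n * Real.sin θ = Real.sin (n * θ) := by
  induction n using Nat.twoStepInduction with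
  | zero => simp [tcCheb]
  | one => simp [tcCheb]
  | more n h1 h2 =>
    have e1 : ((n + 2 : ℕ) : ℝ) * θ = ((n + 1 : ℕ) : ℝ) * θ + θ := by push_cast; ring
    have e2 : (n : ℝ) * θ = ((n + 1 : ℕ) : ℝ) * θ - θ := by push_cast; ring
    have : tcCheb (-2 * Real.cos θ) (n + 2) * Real.sin θ =
      2 * Real.cos θ * (tcCheb (-2 * Real.cos θ) (n + 1) * Real.sin θ)
        - tcCheb (-2 * Real.cos θ) n * Real.sin θ := by rw [tcCheb]; ring
    rw [this, h1, h2, e1, e2, Real.sin_add, Real.sin_sub]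
    ring

theorem tc_cheb_nonneg {s t : B} (h : s ≠ t) (n : ℕ) (hn : M s t = 0 ∨ n ≤ M s t) :
    0 ≤ tcCheb (coxEntry M s t) n := by
  unfold coxEntry
  split_ifs with h0
  · rw [tc_cheb_infty]; positivity
  · have hn := hn.resolve_left h0
    have h2 : 2 ≤ M s t := tc_two_le M h h0
    have h3 : (2:ℝ) ≤ (M s t : ℝ) := by exact_mod_cast h2
    have hpos : (0:ℝ) < M s t := by linarith
    have hθ : 0 < Real.sin (Real.pi / (M s t)) := by
      apply Real.sin_pos_of_pos_of_lt_pi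
      · have := Real.pi_pos; positivity
      · exact div_lt_self Real.pi_pos (by linarith)
    have e := tc_cheb_sin (Real.pi / (M s t)) n
    have : 0 ≤ Real.sin (n * (Real.pi / (M s t))) := by
      apply Real.sin_nonneg_of_nonneg_of_le_pi
      · have := Real.pi_pos; positivity
      · have hn' : (n:ℝ) ≤ M s t := by exact_mod_cast hn
        calc (n:ℝ) * (Real.pi / (M s t)) ≤ M s t * (Real.pi / (M s t)) := by
              have := Real.pi_pos; gcongr
          _ = Real.pi := by field_simp
    rw [← e] at this
    exact nonneg_of_mul_nonneg_left this hθ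

theorem tc_alt (hρ : ∀ (s : B) (v : B → ℝ),
      ρ (cs.simple s) v = v - coxForm M (simpleRoot s) v • simpleRoot s)
    (s t : B) (j : ℕ) :
    ρ (cs.wordProd (CoxeterSystem.alternatingWord s t j)) (simpleRoot s) =
      if Even j then
        tcCheb (coxEntry M s t) (j + 1) • simpleRoot s + tcCheb (coxEntry M s t) j • simpleRoot t
      else
        tcCheb (coxEntry M s t) j • simpleRoot s +
          tcCheb (coxEntry M s t) (j + 1) • simpleRoot t := by
  induction j with
  | zero => simp [CoxeterSystem.alternatingWord, tcCheb]
  | succ j ih =>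
    rw [CoxeterSystem.alternatingWord_succ', CoxeterSystem.wordProd_cons, tc_mul, ih]
    by_cases hj : Even j
    · have : ¬ Even (j + 1) := by simp [hj, parity_simps]
      simp only [hj, this, if_true, if_false]
      rw [hρ, tc_add_right, tc_smul_right, tc_smul_right, tc_simple_simple, tc_simple_simple,
        tc_entry_diag, tc_entry_symm M t s, tcCheb]
      module
    · have : Even (j + 1) := by simp [hj, parity_simps]
      simp only [hj, this, if_true, if_false]
      rw [hρ, tc_add_right, tc_smul_right, tc_smul_right, tc_simple_simple, tc_simple_simple,
        tc_entry_diag, tcCheb]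
      module

theorem tc_pos_aux (hρ : ∀ (s : B) (v : B → ℝ),
      ρ (cs.simple s) v = v - coxForm M (simpleRoot s) v • simpleRoot s)
    (n : ℕ) : ∀ (w : W) (s : B), cs.length w ≤ n →
    cs.length (w * cs.simple s) = cs.length w + 1 → ∀ i, 0 ≤ ρ w (simpleRoot s) i := by
  induction n with
  | zero =>
    intro w s hw _ i
    have : w = 1 := cs.length_eq_zero_iff.1 (by omega)
    subst this
    rw [tc_one]; exact tc_simple_nonneg s i
  | succ n ih =>
    intro w s hw hs i
    by_cases hw1 : w = 1
    · subst hw1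
      rw [tc_one]; exact tc_simple_nonneg s i
    obtain ⟨t, ht⟩ := cs.exists_rightDescent_of_ne_one hw1
    rw [cs.isRightDescent_iff] at ht
    have hst : s ≠ t := by
      rintro rfl
      omega
    let P : ℕ → Prop := fun j => ∃ u, w = u * cs.wordProd (CoxeterSystem.alternatingWord s t j) ∧
      cs.length w = cs.length u + j
    have hP1 : P 1 := by
      refine ⟨w * cs.simple t, ?_, ht.symm⟩
      simp [CoxeterSystem.alternatingWord]
    classical
    have hbound : ∀ j, P j → j ≤ cs.length w := by
      rintro j ⟨u, _, h⟩; omega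
    obtain ⟨j, hj1, ⟨u, hu, hul⟩, hmax⟩ : ∃ j, 1 ≤ j ∧ P j ∧ ∀ k, P k → k ≤ j := by
      refine ⟨Nat.findGreatest P (cs.length w), Nat.le_findGreatest (hbound 1 hP1) hP1,
        Nat.findGreatest_spec (hbound 1 hP1) hP1,
        fun k hk => Nat.le_findGreatest (hbound k hk) hk⟩
    -- outer letters
    have hasc : ∀ x, x = s ∨ x = t → cs.length (u * cs.simple x) = cs.length u + 1 := by
      obtain ⟨j', rfl⟩ : ∃ j', j = j' + 1 := ⟨j - 1, by omega⟩
      have hfirst : cs.length (u * cs.simple (if Even j' then t else s)) = cs.length u + 1 := by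
        have h1 := hu
        rw [CoxeterSystem.alternatingWord_succ', CoxeterSystem.wordProd_cons, ← mul_assoc] at h1
        have h2 := cs.length_mul_le (u * cs.simple (if Even j' then t else s))
          (cs.wordProd (CoxeterSystem.alternatingWord s t j'))
        have h3 := cs.length_wordProd_le (CoxeterSystem.alternatingWord s t j')
        rw [CoxeterSystem.length_alternatingWord] at h3
        rw [← h1] at h2
        rcases cs.length_mul_simple u (if Even j' then t else s) with h | h <;> omega
      have hsecond : cs.length (u * cs.simple (if Even (j' + 1) then t else s))
          = cs.length u + 1 := by
        rcases cs.length_mul_simple u (if Even (j' + 1) then t else s) with h | h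
        · exact h
        · exfalso
          have := hmax (j' + 1 + 1) ⟨u * cs.simple (if Even (j' + 1) then t else s), ?_, by omega⟩
          · omega
          · rw [CoxeterSystem.alternatingWord_succ', CoxeterSystem.wordProd_cons, mul_assoc,
              cs.simple_mul_simple_cancel_left]
            exact hu
      by_cases he : Even j'
      · have he' : ¬ Even (j' + 1) := by simp [he, parity_simps]
        simp only [he, he', if_true, if_false] at hfirst hsecond
        rintro x (rfl | rfl) <;> assumption
      · have he' : Even (j' + 1) := by simp [he, parity_simps]
        simp only [he, he', if_true, if_false] at hfirst hsecond
        rintro x (rfl | rfl) <;> assumption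
    have hjm : M s t = 0 ∨ j + 1 ≤ M s t := by
      by_contra hcon
      push Not at hcon
      obtain ⟨h0, hlt⟩ := hcon
      have hnr := cs.not_isReduced_alternatingWord t s (m := j + 1)
        (by rw [M.symmetric]; exact h0) (by rw [M.symmetric]; exact hlt)
      have h3 := cs.length_wordProd_le (CoxeterSystem.alternatingWord t s (j + 1))
      have h4 : cs.length (cs.wordProd (CoxeterSystem.alternatingWord t s (j + 1))) ≠
        (CoxeterSystem.alternatingWord t s (j + 1)).length := hnr
      rw [CoxeterSystem.length_alternatingWord] at h3 h4
      have h5 : w * cs.simple s = u * cs.wordProd (CoxeterSystem.alternatingWord t s (j + 1)) := by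
        rw [CoxeterSystem.alternatingWord_succ, CoxeterSystem.wordProd_concat, ← mul_assoc, ← hu]
      have h6 := cs.length_mul_le u (cs.wordProd (CoxeterSystem.alternatingWord t s (j + 1)))
      rw [← h5] at h6
      omega
    have hus := ih u s (by omega) (hasc s (Or.inl rfl)) i
    have hut := ih u t (by omega) (hasc t (Or.inr rfl)) i
    have c1 := tc_cheb_nonneg (M := M) hst (j + 1) hjm
    have c2 := tc_cheb_nonneg (M := M) hst j (hjm.imp id (by intro h; omega))
    rw [hu, tc_mul, tc_alt cs ρ hρ]
    split_ifs
    · simp only [map_add, map_smul, Pi.add_apply, Pi.smul_apply, smul_eq_mul]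
      positivity
    · simp only [map_add, map_smul, Pi.add_apply, Pi.smul_apply, smul_eq_mul]
      positivity

/-- Every root is nonnegative or nonpositive. -/
theorem tc_root_sign (hρ : ∀ (s : B) (v : B → ℝ),
      ρ (cs.simple s) v = v - coxForm M (simpleRoot s) v • simpleRoot s)
    (w : W) (s : B) :
    (∀ i, 0 ≤ ρ w (simpleRoot s) i) ∨ (∀ i, ρ w (simpleRoot s) i ≤ 0) := by
  rcases cs.length_mul_simple w s with h | h
  · exact Or.inl (tc_pos_aux cs ρ hρ _ w s le_rfl h)
  · right
    intro i
    have := tc_pos_aux cs ρ hρ _ (w * cs.simple s) s le_rfl (by simpa using h.symm) i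
    rw [tc_mul, tc_refl_self cs ρ hρ, map_neg, Pi.neg_apply] at this
    linarith

theorem tc_root_norm (hρ : ∀ (s : B) (v : B → ℝ),
      ρ (cs.simple s) v = v - coxForm M (simpleRoot s) v • simpleRoot s)
    {β : B → ℝ} (h : β ∈ rootSet ρ) : coxForm M β β = 2 := by
  obtain ⟨w, s, rfl⟩ := h
  rw [tc_invariant cs ρ hρ, tc_simple_simple, tc_entry_diag]

theorem tc_root_act {β : B → ℝ} (w : W) (h : β ∈ rootSet ρ) : ρ w β ∈ rootSet ρ := by
  obtain ⟨u, s, rfl⟩ := h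
  exact ⟨w * u, s, by rw [tc_mul]⟩

theorem tc_sign (hρ : ∀ (s : B) (v : B → ℝ),
      ρ (cs.simple s) v = v - coxForm M (simpleRoot s) v • simpleRoot s)
    {β : B → ℝ} (h : β ∈ rootSet ρ) : (∀ i, 0 ≤ β i) ∨ (∀ i, β i ≤ 0) := by
  obtain ⟨w, s, rfl⟩ := h
  exact tc_root_sign cs ρ hρ w s

theorem tc_root_ne (hρ : ∀ (s : B) (v : B → ℝ),
      ρ (cs.simple s) v = v - coxForm M (simpleRoot s) v • simpleRoot s)
    {β : B → ℝ} (h : β ∈ rootSet ρ) : β ≠ 0 := by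
  rintro rfl
  have := tc_root_norm cs ρ hρ h
  simp [coxForm] at this

theorem tc_simple_pos (s : B) : simpleRoot s ∈ posRootSet ρ :=
  ⟨⟨1, s, by rw [tc_one]⟩, fun i => tc_simple_nonneg s i⟩

theorem tc_simple_permute (hρ : ∀ (s : B) (v : B → ℝ),
      ρ (cs.simple s) v = v - coxForm M (simpleRoot s) v • simpleRoot s)
    {β : B → ℝ} (s : B) (h : β ∈ posRootSet ρ) (hne : β ≠ simpleRoot s) :
    ρ (cs.simple s) β ∈ posRootSet ρ := by
  have hr := tc_root_act ρ (cs.simple s) h.1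
  refine ⟨hr, (tc_sign cs ρ hρ hr).resolve_right ?_⟩
  intro hneg
  apply hne
  have hz : ∀ i, i ≠ s → β i = 0 := by
    intro i hi
    have h1 := hneg i
    rw [hρ] at h1
    simp only [simpleRoot, Pi.sub_apply, Pi.smul_apply, Pi.single_eq_of_ne hi, smul_eq_mul,
      mul_zero, sub_zero] at h1
    exact le_antisymm h1 (h.2 i)
  have hβ : β = β s • simpleRoot s := by
    ext i
    by_cases hi : i = s
    · subst hi; simp [simpleRoot]
    · simp [simpleRoot, Pi.single_eq_of_ne hi, hz i hi]
  have hn := tc_root_norm cs ρ hρ h.1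
  rw [hβ, tc_smul_left, tc_smul_right, tc_simple_simple, tc_entry_diag] at hn
  have h0 := h.2 s
  have : β s = 1 := by nlinarith
  rw [hβ, this, one_smul]

theorem tc_neg_not_pos (hρ : ∀ (s : B) (v : B → ℝ),
      ρ (cs.simple s) v = v - coxForm M (simpleRoot s) v • simpleRoot s)
    {s : B} : - simpleRoot s ∉ posRootSet ρ := by
  intro h
  have := h.2 s
  simp [simpleRoot] at this
  linarith

theorem tc_invol (hρ : ∀ (s : B) (v : B → ℝ),
      ρ (cs.simple s) v = v - coxForm M (simpleRoot s) v • simpleRoot s)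
    (s : B) (v : B → ℝ) : ρ (cs.simple s) (ρ (cs.simple s) v) = v := by
  rw [← tc_mul, cs.simple_mul_simple_self, tc_one]

theorem tc_inversions_finite (hρ : ∀ (s : B) (v : B → ℝ),
      ρ (cs.simple s) v = v - coxForm M (simpleRoot s) v • simpleRoot s)
    (w : W) :
    {β ∈ posRootSet ρ | ρ w β ∉ posRootSet ρ}.Finite := by
  refine cs.simple_induction_left
    (p := fun w => {β ∈ posRootSet ρ | ρ w β ∉ posRootSet ρ}.Finite) w ?_ ?_
  · convert Set.finite_empty
    ext β
    simp only [tc_one]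
    simp
  · intro w s ih
    refine (ih.union (Set.finite_singleton (ρ w⁻¹ (simpleRoot s)))).subset ?_
    rintro β ⟨hβ, hn⟩
    by_cases h : ρ w β ∈ posRootSet ρ
    · right
      rw [tc_mul] at hn
      have : ρ w β = simpleRoot s := by
        by_contra hne
        exact hn (tc_simple_permute cs ρ hρ s h hne)
      rw [Set.mem_singleton_iff, ← this, tc_inv_apply']
    · exact Or.inl ⟨hβ, h⟩

/-- dual of the Tits cone -/
def tcDual {B : Type*} {W : Type*} [Group W] (ρ : W →* ((B → ℝ) ≃ₗ[ℝ] (B → ℝ))) :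
    Set (B → ℝ) := {v | ∀ w i, 0 ≤ ρ w v i}

theorem tc_dual_nonneg {v : B → ℝ} (h : v ∈ tcDual ρ) (i : B) : 0 ≤ v i := by
  have := h 1 i
  rwa [tc_one] at this

theorem tc_dual_act {v : B → ℝ} (h : v ∈ tcDual ρ) (w : W) : ρ w v ∈ tcDual ρ := by
  intro u i
  rw [← tc_mul]; exact h _ i

theorem tc_dual_closed : IsClosed (tcDual ρ) := by
  have : tcDual ρ = ⋂ w, ⋂ i, {v | 0 ≤ ρ w v i} := by
    ext v; simp [tcDual]
  rw [this]
  refine isClosed_iInter fun w => isClosed_iInter fun i => ?_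
  exact isClosed_le continuous_const ((continuous_apply i).comp (tc_rho_continuous ρ w))

theorem tc_decomp (v : B → ℝ) : v = ∑ s, v s • simpleRoot s := by
  ext i
  simp only [Finset.sum_apply, Pi.smul_apply, smul_eq_mul, simpleRoot]
  rw [Finset.sum_eq_single i]
  · simp
  · intro b _ hb; simp [Pi.single_eq_of_ne hb.symm]
  · simp

theorem tc_eval_decomp (z v : B → ℝ) (w : W) :
    evalR z (ρ w v) = ∑ s, v s * evalR z (ρ w (simpleRoot s)) := by
  conv_lhs => rw [tc_decomp v]
  simp only [evalR, map_sum, map_smul, Finset.sum_apply, Pi.smul_apply, smul_eq_mul,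
    Finset.sum_mul, Finset.mul_sum]
  rw [Finset.sum_comm]
  refine Finset.sum_congr rfl fun s _ => Finset.sum_congr rfl fun t _ => ?_
  ring

theorem tc_eval_neg (z v : B → ℝ) : evalR z (-v) = - evalR z v := by
  simp [evalR]

/-- `K` is contained in the dual of the Tits cone. -/
theorem tc_K_dual_aux (hρ : ∀ (s : B) (v : B → ℝ),
      ρ (cs.simple s) v = v - coxForm M (simpleRoot s) v • simpleRoot s)
    (n : ℕ) {k : B → ℝ} (hk : k ∈ coneK M) : ∀ w : W,
    {β ∈ posRootSet ρ | ρ w β ∉ posRootSet ρ}.ncard ≤ n → ∀ i, 0 ≤ ρ w k i := by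
  induction n with
  | zero =>
    intro w hw i
    rw [Nat.le_zero, Set.ncard_eq_zero (tc_inversions_finite cs ρ hρ w)] at hw
    have hp : ∀ s, ρ w (simpleRoot s) ∈ posRootSet ρ := by
      intro s
      by_contra h
      have : simpleRoot s ∈ ({β ∈ posRootSet ρ | ρ w β ∉ posRootSet ρ} : Set (B → ℝ)) :=
        ⟨tc_simple_pos ρ s, h⟩
      rw [hw] at this
      exact this
    rw [tc_decomp k]
    simp only [map_sum, map_smul, Finset.sum_apply, Pi.smul_apply, smul_eq_mul]
    exact Finset.sum_nonneg fun s _ => mul_nonneg (hk.1 s) ((hp s).2 i)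
  | succ n ih =>
    intro w hw i
    by_cases hall : ∀ s, ρ w (simpleRoot s) ∈ posRootSet ρ
    · rw [tc_decomp k]
      simp only [map_sum, map_smul, Finset.sum_apply, Pi.smul_apply, smul_eq_mul]
      exact Finset.sum_nonneg fun s _ => mul_nonneg (hk.1 s) ((hall s).2 i)
    push Not at hall
    obtain ⟨s, hs⟩ := hall
    have hneg : ∀ i, ρ w (simpleRoot s) i ≤ 0 := by
      rcases tc_root_sign cs ρ hρ w s with h | h
      · exact absurd ⟨⟨w, s, rfl⟩, h⟩ hs
      · exact h
    have hcard : {β ∈ posRootSet ρ | ρ (w * cs.simple s) β ∉ posRootSet ρ}.ncard ≤ n := by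
      have hfin := tc_inversions_finite cs ρ hρ w
      have hmem : simpleRoot s ∈ ({β ∈ posRootSet ρ | ρ w β ∉ posRootSet ρ} : Set (B → ℝ)) :=
        ⟨tc_simple_pos ρ s, hs⟩
      have h1 := Set.ncard_sdiff_singleton_add_one hmem hfin
      have h2 : {β ∈ posRootSet ρ | ρ (w * cs.simple s) β ∉ posRootSet ρ}.ncard ≤
          ({β ∈ posRootSet ρ | ρ w β ∉ posRootSet ρ} \ {simpleRoot s}).ncard := by
        refine Set.ncard_le_ncard_of_injOn (fun β => ρ (cs.simple s) β) ?_
          (fun a _ b _ hab => (ρ (cs.simple s)).injective hab) hfin.sdiff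
        rintro β ⟨hβ, hn⟩
        rw [tc_mul] at hn
        have hne : β ≠ simpleRoot s := by
          rintro rfl
          apply hn
          rw [tc_refl_self cs ρ hρ, map_neg]
          refine ⟨⟨w * cs.simple s, s, ?_⟩, fun i => ?_⟩
          · rw [tc_mul, tc_refl_self cs ρ hρ, map_neg]
          · have := hneg i
            simp only [Pi.neg_apply]; linarith
        refine ⟨⟨tc_simple_permute cs ρ hρ s hβ hne, hn⟩, ?_⟩
        intro h
        rw [Set.mem_singleton_iff] at h
        have h' := tc_invol cs ρ hρ s β
        rw [h, tc_refl_self cs ρ hρ] at h'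
        exact tc_neg_not_pos cs ρ hρ (h' ▸ hβ)
      omega
    have h3 := ih (w * cs.simple s) hcard i
    rw [tc_mul, hρ, map_sub, map_smul] at h3
    simp only [Pi.sub_apply, Pi.smul_apply, smul_eq_mul] at h3
    have h4 := hk.2 s
    rw [tc_symm] at h4
    have h5 := hneg i
    nlinarith [mul_nonneg_of_nonpos_of_nonpos h4 h5]

theorem tc_K_dual (hρ : ∀ (s : B) (v : B → ℝ),
      ρ (cs.simple s) v = v - coxForm M (simpleRoot s) v • simpleRoot s)
    {k : B → ℝ} (hk : k ∈ coneK M) : k ∈ tcDual ρ :=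
  fun w i => tc_K_dual_aux cs ρ hρ _ hk w le_rfl i

theorem tc_imag_sub_dual (hρ : ∀ (s : B) (v : B → ℝ),
      ρ (cs.simple s) v = v - coxForm M (simpleRoot s) v • simpleRoot s)
    : imagCone M ρ ⊆ tcDual ρ := by
  refine closure_minimal ?_ (tc_dual_closed ρ)
  rintro v ⟨w, k, hk, rfl⟩
  exact tc_dual_act ρ (tc_K_dual cs ρ hρ hk) w

theorem tc_finite_mem (hρ : ∀ (s : B) (v : B → ℝ),
      ρ (cs.simple s) v = v - coxForm M (simpleRoot s) v • simpleRoot s)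
    (n : ℕ) (z : B → ℝ) : ∀ w : W,
    {β ∈ posRootSet ρ | evalR z (ρ w β) < 0}.Finite →
    {β ∈ posRootSet ρ | evalR z (ρ w β) < 0}.ncard ≤ n → z ∈ titsConeCoord ρ := by
  induction n with
  | zero =>
    intro w hfin hw
    rw [Nat.le_zero, Set.ncard_eq_zero hfin] at hw
    refine ⟨w, fun s => ?_⟩
    by_contra h
    have : simpleRoot s ∈ ({β ∈ posRootSet ρ | evalR z (ρ w β) < 0} : Set (B → ℝ)) :=
      ⟨tc_simple_pos ρ s, not_le.1 h⟩
    rw [hw] at this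
    exact this
  | succ n ih =>
    intro w hfin hw
    by_cases hall : ∀ s, 0 ≤ evalR z (ρ w (simpleRoot s))
    · exact ⟨w, hall⟩
    push Not at hall
    obtain ⟨s, hs⟩ := hall
    have hmem : simpleRoot s ∈ ({β ∈ posRootSet ρ | evalR z (ρ w β) < 0} : Set (B → ℝ)) :=
        ⟨tc_simple_pos ρ s, hs⟩
    have h1 := Set.ncard_sdiff_singleton_add_one hmem hfin
    have hmaps : ∀ β ∈ ({β ∈ posRootSet ρ | evalR z (ρ (w * cs.simple s) β) < 0} : Set (B → ℝ)),
        ρ (cs.simple s) β ∈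
          ({β ∈ posRootSet ρ | evalR z (ρ w β) < 0} \ {simpleRoot s} : Set (B → ℝ)) := by
      rintro β ⟨hβ, hn⟩
      rw [tc_mul] at hn
      have hne : β ≠ simpleRoot s := by
        rintro rfl
        rw [tc_refl_self cs ρ hρ, map_neg, tc_eval_neg] at hn
        linarith
      refine ⟨⟨tc_simple_permute cs ρ hρ s hβ hne, hn⟩, ?_⟩
      intro h
      rw [Set.mem_singleton_iff] at h
      have h' := tc_invol cs ρ hρ s β
      rw [h, tc_refl_self cs ρ hρ] at h'
      exact tc_neg_not_pos cs ρ hρ (h' ▸ hβ)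
    have hinj : Set.InjOn (fun β => ρ (cs.simple s) β)
        ({β ∈ posRootSet ρ | evalR z (ρ (w * cs.simple s) β) < 0} : Set (B → ℝ)) :=
      fun a _ b _ hab => (ρ (cs.simple s)).injective hab
    have h2 := Set.ncard_le_ncard_of_injOn (fun β => ρ (cs.simple s) β) hmaps hinj hfin.sdiff
    exact ih (w * cs.simple s) (Set.Finite.of_injOn hmaps hinj hfin.sdiff) (by omega)

/-- key compactness lemma -/
theorem tc_limit (hρ : ∀ (s : B) (v : B → ℝ),
      ρ (cs.simple s) v = v - coxForm M (simpleRoot s) v • simpleRoot s)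
    {z : B → ℝ} (hz : z ∉ titsConeCoord ρ) :
    ∃ y ∈ tcDual ρ, y ≠ 0 ∧
      y ∈ closure {b | ∃ c : ℝ, 0 < c ∧ ∃ β ∈ posRootSet ρ, evalR z β < 0 ∧ b = c • β} := by
  have hinf : {β ∈ posRootSet ρ | evalR z β < 0}.Infinite := by
    intro hfin
    apply hz
    refine tc_finite_mem cs ρ hρ _ z 1 ?_ le_rfl
    simpa only [tc_one] using hfin
  let f := hinf.natEmbedding
  let β : ℕ → (B → ℝ) := fun n => (f n : B → ℝ)
  have hβinj : Function.Injective β := fun a b h => f.injective (Subtype.ext h)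
  have hβ : ∀ n, β n ∈ posRootSet ρ ∧ evalR z (β n) < 0 := fun n => (f n).2
  have hht : ∀ n, 0 < ∑ i, β n i := by
    intro n
    have h0 := (hβ n).1.2
    refine lt_of_le_of_ne (Finset.sum_nonneg fun i _ => h0 i) ?_
    intro h
    apply tc_root_ne cs ρ hρ (hβ n).1.1
    ext i
    exact (Finset.sum_eq_zero_iff_of_nonneg fun i _ => h0 i).1 h.symm i (Finset.mem_univ i)
  let b : ℕ → (B → ℝ) := fun n => (∑ i, β n i)⁻¹ • β n
  have hb : ∀ n, b n ∈ stdSimplex ℝ B := by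
    intro n
    refine ⟨fun i => mul_nonneg (inv_nonneg.2 (hht n).le) ((hβ n).1.2 i), ?_⟩
    simp only [b, Pi.smul_apply, smul_eq_mul, ← Finset.mul_sum]
    exact inv_mul_cancel₀ (hht n).ne'
  obtain ⟨y, hy, φ, hφ, hlim⟩ := (isCompact_stdSimplex ℝ B).tendsto_subseq hb
  refine ⟨y, ?_, ?_, ?_⟩
  · intro w i
    have hev : ∀ᶠ n in Filter.atTop, 0 ≤ ρ w (b (φ n)) i := by
      have hfin := (tc_inversions_finite cs ρ hρ w).preimage
        ((hβinj.comp hφ.injective).injOn (s := _))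
      have := hfin.compl_mem_cofinite
      rw [Nat.cofinite_eq_atTop] at this
      filter_upwards [this] with n hn
      have hp : ρ w (β (φ n)) ∈ posRootSet ρ := by
        by_contra h
        exact hn ⟨(hβ _).1, h⟩
      simp only [b, map_smul, Pi.smul_apply, smul_eq_mul]
      exact mul_nonneg (inv_nonneg.2 (hht _).le) (hp.2 i)
    have hc : Continuous fun v => ρ w v i := (continuous_apply i).comp (tc_rho_continuous ρ w)
    exact ge_of_tendsto ((hc.tendsto y).comp hlim) hev
  · rintro rfl
    have := hy.2
    simp at this
  · exact mem_closure_of_tendsto hlim (Filter.Eventually.of_forall fun n =>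
      ⟨_, inv_pos.2 (hht _), β (φ n), (hβ _).1, (hβ _).2, rfl⟩)

theorem tc_ht_pos {v : B → ℝ} (h : v ∈ tcDual ρ) (hne : v ≠ 0) : 0 < ∑ i, v i := by
  have h0 := tc_dual_nonneg ρ h
  refine lt_of_le_of_ne (Finset.sum_nonneg fun i _ => h0 i) ?_
  intro h
  apply hne
  ext i
  exact (Finset.sum_eq_zero_iff_of_nonneg fun i _ => h0 i).1 h.symm i (Finset.mem_univ i)

/-- elements of the dual cone have nonpositive norm -/
theorem tc_dual_norm (hρ : ∀ (s : B) (v : B → ℝ),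
      ρ (cs.simple s) v = v - coxForm M (simpleRoot s) v • simpleRoot s)
    {v : B → ℝ} (hv : v ∈ tcDual ρ) : coxForm M v v ≤ 0 := by
  let H : W → ℝ := fun w => ∑ i, ρ w v i
  have hH0 : ∀ w, 0 ≤ H w := fun w => Finset.sum_nonneg fun i _ => hv w i
  have hbdd : BddBelow (Set.range H) := ⟨0, by rintro _ ⟨w, rfl⟩; exact hH0 w⟩
  set h := ⨅ w, H w with hh
  have hle : ∀ w, h ≤ H w := fun w => ciInf_le hbdd w
  have key : ∀ δ : ℝ, 0 < δ → coxForm M v v ≤ δ * (h + δ) := by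
    intro δ hδ
    obtain ⟨w, hw⟩ := exists_lt_of_ciInf_lt (show (⨅ w, H w) < h + δ by linarith)
    rw [← tc_invariant cs ρ hρ w, tc_expand]
    have hs : ∀ s, coxForm M (simpleRoot s) (ρ w v) ≤ δ := by
      intro s
      have h1 := hle (cs.simple s * w)
      have h2 : H (cs.simple s * w) = H w - coxForm M (simpleRoot s) (ρ w v) := by
        simp only [H]
        rw [tc_mul, hρ]
        simp [Finset.sum_sub_distrib, ← Finset.mul_sum, simpleRoot]
      linarith
    calc ∑ s, ρ w v s * coxForm M (simpleRoot s) (ρ w v) ≤ ∑ s, ρ w v s * δ :=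
          Finset.sum_le_sum fun s _ => mul_le_mul_of_nonneg_left (hs s) (hv w s)
      _ = δ * H w := by rw [← Finset.sum_mul, mul_comm]
      _ ≤ δ * (h + δ) := mul_le_mul_of_nonneg_left hw.le hδ.le
  have hlim : Filter.Tendsto (fun δ : ℝ => δ * (h + δ)) (nhdsWithin 0 (Set.Ioi 0)) (nhds 0) := by
    have : Continuous fun δ : ℝ => δ * (h + δ) := by fun_prop
    have := this.tendsto 0
    simp only [zero_mul] at this
    exact this.mono_left nhdsWithin_le_nhds
  refine ge_of_tendsto hlim ?_
  filter_upwards [self_mem_nhdsWithin] with δ hδ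
  exact key δ hδ

/-- coordinate projection -/
def tcProj {B : Type*} [DecidableEq B] (J : Finset B) (v : B → ℝ) : B → ℝ :=
  fun i => if i ∈ J then v i else 0

theorem tc_proj_comm (hρ : ∀ (s : B) (v : B → ℝ),
      ρ (cs.simple s) v = v - coxForm M (simpleRoot s) v • simpleRoot s)
    (J : Finset B) (hJ : ∀ s ∈ J, ∀ t, t ∉ J → coxEntry M s t = 0)
    (w : W) (v : B → ℝ) : ρ w (tcProj J v) = tcProj J (ρ w v) := by
  refine cs.simple_induction_left (p := fun w => ρ w (tcProj J v) = tcProj J (ρ w v)) w ?_ ?_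
  · simp only [tc_one]
  · intro w s ih
    rw [tc_mul, tc_mul, ih]
    generalize ρ w v = u
    rw [hρ, hρ]
    ext i
    simp only [tcProj, Pi.sub_apply, Pi.smul_apply, smul_eq_mul, tc_simple_left]
    by_cases hs : s ∈ J
    · have : ∑ t, (if t ∈ J then u t else 0) * coxEntry M s t = ∑ t, u t * coxEntry M s t := by
        refine Finset.sum_congr rfl fun t _ => ?_
        split_ifs with ht
        · rfl
        · rw [hJ s hs t ht]; ring
      rw [this]
      split_ifs with hi
      · rfl
      · have : i ≠ s := by rintro rfl; exact hi hs
        simp [simpleRoot, Pi.single_eq_of_ne this]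
    · have : ∑ t, (if t ∈ J then u t else 0) * coxEntry M s t = 0 := by
        refine Finset.sum_eq_zero fun t _ => ?_
        split_ifs with ht
        · rw [tc_entry_symm, hJ t ht s hs]; ring
        · ring
      rw [this]
      split_ifs with hi
      · have : i ≠ s := by rintro rfl; exact hs hi
        simp [simpleRoot, Pi.single_eq_of_ne this]
      · ring

theorem tc_proj_dual (hρ : ∀ (s : B) (v : B → ℝ),
      ρ (cs.simple s) v = v - coxForm M (simpleRoot s) v • simpleRoot s)
    (J : Finset B) (hJ : ∀ s ∈ J, ∀ t, t ∉ J → coxEntry M s t = 0)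
    {v : B → ℝ} (hv : v ∈ tcDual ρ) : tcProj J v ∈ tcDual ρ := by
  intro w i
  rw [tc_proj_comm cs ρ hρ J hJ]
  unfold tcProj
  split_ifs
  · exact hv w i
  · exact le_rfl

theorem tc_eval_form (x β : B → ℝ) :
    evalR (fun s => - coxForm M x (simpleRoot s)) β = - coxForm M x β := by
  rw [tc_symm M x β, tc_expand M β x]
  simp only [evalR, mul_neg, Finset.sum_neg_distrib]
  congr 1
  exact Finset.sum_congr rfl fun s _ => by rw [tc_symm]

theorem tc_root_refl (hρ : ∀ (s : B) (v : B → ℝ),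
      ρ (cs.simple s) v = v - coxForm M (simpleRoot s) v • simpleRoot s)
    {v β : B → ℝ} (hv : v ∈ tcDual ρ) (hβ : β ∈ rootSet ρ) :
    ∀ i, 0 ≤ (v - coxForm M v β • β) i := by
  obtain ⟨w, s, rfl⟩ := hβ
  intro i
  have h := hv (w * (cs.simple s * w⁻¹)) i
  rw [tc_mul, tc_mul, hρ, map_sub, map_smul, tc_inv_apply] at h
  have e : coxForm M (simpleRoot s) (ρ w⁻¹ v) = coxForm M v (ρ w (simpleRoot s)) := by
    rw [← tc_invariant cs ρ hρ w, tc_inv_apply, tc_symm]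
  rwa [e] at h

/-- indefinite case -/
theorem tc_indef (hρ : ∀ (s : B) (v : B → ℝ),
      ρ (cs.simple s) v = v - coxForm M (simpleRoot s) v • simpleRoot s)
    (J : Finset B) (k : B → ℝ) (lam : ℝ) (hlam : lam < 0)
    (hk0 : ∀ i, 0 ≤ k i) (hkJ : ∀ i, i ∈ J ↔ k i ≠ 0)
    (hk : ∀ s, coxForm M k (simpleRoot s) = lam * k s)
    (hJ : ∀ s ∈ J, ∀ t, t ∉ J → coxEntry M s t = 0)
    {v : B → ℝ} (hv : v ∈ tcDual ρ) (hvJ : ∀ i, i ∉ J → v i = 0) : v ∈ imagCone M ρ := by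
  have hkK : k ∈ coneK M := ⟨hk0, fun s => by
    rw [hk]; exact mul_nonpos_of_nonpos_of_nonneg hlam.le (hk0 s)⟩
  have hkform : ∀ y, coxForm M k y = lam * ∑ i, k i * y i := by
    intro y
    rw [tc_symm, tc_expand, Finset.mul_sum]
    refine Finset.sum_congr rfl fun s _ => ?_
    rw [tc_symm, hk]; ring
  have hkd := tc_K_dual cs ρ hρ hkK
  have main : ∀ ε : ℝ, 0 < ε → ∃ w : W, ∃ k' ∈ coneK M, v + ε • k = ρ w k' := by
    intro ε hε
    set x := v + ε • k with hx
    have hxd : x ∈ tcDual ρ := by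
      intro w i
      simp only [hx, map_add, map_smul, Pi.add_apply, Pi.smul_apply, smul_eq_mul]
      exact add_nonneg (hv w i) (mul_nonneg hε.le (hkd w i))
    have hxJ : ∀ i, i ∉ J → x i = 0 := by
      intro i hi
      have : k i = 0 := by
        by_contra h
        exact hi ((hkJ i).2 h)
      simp [hx, hvJ i hi, this]
    have hz : (fun s => - coxForm M x (simpleRoot s)) ∈ titsConeCoord ρ := by
      by_contra hz
      obtain ⟨y, hy, hy0, hcl⟩ := tc_limit cs ρ hρ hz
      let F : Set (B → ℝ) := {b | 0 ≤ coxForm M x b ∧ (∀ i, i ∉ J → b i = 0) ∧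
        coxForm M v b * (∑ i, b i) ≤ (∑ i, v i) * (coxForm M b b / 2)}
      have hFc : IsClosed F := by
        refine (isClosed_le continuous_const (tc_continuous M continuous_const continuous_id)).inter
          (IsClosed.inter ?_ ?_)
        · have : {b : B → ℝ | ∀ i, i ∉ J → b i = 0} = ⋂ i, ⋂ (_ : i ∉ J), {b | b i = 0} := by
            ext b; simp
          change IsClosed {b : B → ℝ | ∀ i, i ∉ J → b i = 0}
          rw [this]
          exact isClosed_iInter fun i => isClosed_iInter fun _ =>
            isClosed_eq (continuous_apply i) continuous_const
        · have c1 : Continuous fun b => coxForm M v b :=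
            tc_continuous M continuous_const continuous_id
          have c2 : Continuous fun b => coxForm M b b :=
            tc_continuous M continuous_id continuous_id
          have c3 : Continuous fun b : B → ℝ => coxForm M v b * (∑ i, b i) := by fun_prop
          have c4 : Continuous fun b : B → ℝ => (∑ i, v i) * (coxForm M b b / 2) := by fun_prop
          exact isClosed_le c3 c4
      have hyF : y ∈ F := by
        refine closure_minimal ?_ hFc hcl
        rintro b ⟨c, hc, β, hβ, hneg, rfl⟩
        rw [tc_eval_form] at hneg
        have hxβ : 0 < coxForm M x β := by linarith
        refine ⟨?_, ?_, ?_⟩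
        · rw [tc_smul_right]; positivity
        · obtain ⟨⟨w, s, rfl⟩, hp⟩ := hβ
          by_cases hs : s ∈ J
          · intro i hi
            have e : simpleRoot s = tcProj J (simpleRoot s) := by
              ext t
              unfold tcProj
              split_ifs with ht
              · rfl
              · have : t ≠ s := by rintro rfl; exact ht hs
                simp [simpleRoot, Pi.single_eq_of_ne this]
            rw [e, tc_proj_comm cs ρ hρ J hJ]
            simp [tcProj, hi]
          · exfalso
            have e : (0 : B → ℝ) = tcProj J (simpleRoot s) := by
              ext t
              unfold tcProj
              split_ifs with ht
              · have : t ≠ s := by rintro rfl; exact hs ht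
                simp [simpleRoot, Pi.single_eq_of_ne this]
              · rfl
            have e2 := tc_proj_comm cs ρ hρ J hJ w (simpleRoot s)
            rw [← e, map_zero] at e2
            have : coxForm M x (ρ w (simpleRoot s)) = 0 := by
              unfold coxForm
              refine Finset.sum_eq_zero fun a _ => Finset.sum_eq_zero fun t _ => ?_
              by_cases ha : a ∈ J
              · by_cases ht : t ∈ J
                · have := congrFun e2 t
                  simp only [tcProj, ht, if_true, Pi.zero_apply] at this
                  rw [← this]; ring
                · rw [hJ a ha t ht]; ring
              · rw [hxJ a ha]; ring
            linarith
        · have h1 : 0 ≤ ∑ i, (v - coxForm M v β • β) i :=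
            Finset.sum_nonneg fun i _ => tc_root_refl cs ρ hρ hv hβ.1 i
          simp only [Pi.sub_apply, Pi.smul_apply, smul_eq_mul, Finset.sum_sub_distrib,
            ← Finset.mul_sum] at h1
          rw [tc_smul_right, tc_smul_right, tc_smul_left, tc_root_norm cs ρ hρ hβ.1]
          simp only [Pi.smul_apply, smul_eq_mul, ← Finset.mul_sum]
          have h2 := mul_nonneg (sq_nonneg c) h1
          nlinarith
      obtain ⟨h1, h2, h3⟩ := hyF
      have hyht := tc_ht_pos ρ hy hy0
      have hyq := tc_dual_norm cs ρ hρ hy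
      have hv0 : 0 ≤ ∑ i, v i := Finset.sum_nonneg fun i _ => tc_dual_nonneg ρ hv i
      have h4 : coxForm M v y ≤ 0 := by
        by_contra h
        push Not at h
        have := mul_pos h hyht
        have := mul_nonpos_of_nonneg_of_nonpos hv0 (show coxForm M y y / 2 ≤ 0 by linarith)
        linarith
      have hky : 0 < ∑ i, k i * y i := by
        obtain ⟨i, hi⟩ := Function.ne_iff.1 hy0
        have hiJ : i ∈ J := by
          by_contra h
          exact hi (h2 i h)
        have hki := (hk0 i).lt_of_ne ((hkJ i).1 hiJ).symm
        have hyi := (tc_dual_nonneg ρ hy i).lt_of_ne (Ne.symm hi)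
        exact Finset.sum_pos' (fun j _ => mul_nonneg (hk0 j) (tc_dual_nonneg ρ hy j))
          ⟨i, Finset.mem_univ i, mul_pos hki hyi⟩
      rw [hx, tc_add_left, tc_smul_left, hkform] at h1
      have := mul_pos hε (mul_pos_of_neg_of_neg hlam (neg_neg_of_pos hky))
      nlinarith
    obtain ⟨w, hw⟩ := hz
    refine ⟨w, ρ w⁻¹ x, ⟨fun i => hxd _ i, fun s => ?_⟩, (tc_inv_apply ρ w x).symm⟩
    have := hw s
    rw [tc_eval_form] at this
    rw [← tc_invariant cs ρ hρ w, tc_inv_apply]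
    linarith
  have hlim : Filter.Tendsto (fun ε : ℝ => v + ε • k) (nhdsWithin 0 (Set.Ioi 0)) (nhds v) := by
    have : Continuous fun ε : ℝ => v + ε • k := by fun_prop
    have := this.tendsto 0
    simp only [zero_smul, add_zero] at this
    exact this.mono_left nhdsWithin_le_nhds
  refine mem_closure_of_tendsto hlim ?_
  filter_upwards [self_mem_nhdsWithin] with ε hε
  exact main ε hε

theorem tc_quad {a b : ℝ} (ha : 0 < a) (h : ∀ t : ℝ, 0 ≤ 2 * t * b + t ^ 2 * a) : b = 0 := by
  have := h (-b / a)
  have e : 2 * (-b / a) * b + (-b / a) ^ 2 * a = - (b ^ 2 / a) := by field_simp; ring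
  rw [e] at this
  have h2 : b ^ 2 / a ≤ 0 := by linarith
  have h3 : b ^ 2 ≤ 0 := by
    by_contra hc
    push Not at hc
    have := div_pos hc ha
    linarith
  nlinarith [sq_nonneg b, pow_eq_zero_iff (M₀ := ℝ) (n := 2) (a := b) (by norm_num)]

variable (M) in
theorem tc_form_add_smul (v : B → ℝ) (s : B) (t : ℝ) :
    coxForm M (v + t • simpleRoot s) (v + t • simpleRoot s) =
      coxForm M v v + 2 * t * coxForm M v (simpleRoot s) + t ^ 2 * 2 := by
  simp only [tc_add_left, tc_add_right, tc_smul_left, tc_smul_right, tc_simple_simple,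
    tc_entry_diag]
  rw [tc_symm M (simpleRoot s) v]; ring

theorem tc_sq_add_smul (v : B → ℝ) (s : B) (t : ℝ) :
    ∑ i, (v + t • simpleRoot s) i ^ 2 = ∑ i, v i ^ 2 + 2 * t * v s + t ^ 2 := by
  have : ∀ i, (v + t • simpleRoot s) i ^ 2 =
      v i ^ 2 + (2 * t * v i + t ^ 2) * (Pi.single s (1:ℝ) : B → ℝ) i := by
    intro i
    by_cases hi : i = s
    · subst hi; simp [simpleRoot]; ring
    · simp [simpleRoot, Pi.single_eq_of_ne hi]
  simp only [this, Finset.sum_add_distrib]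
  have h2 : ∑ i, (2 * t * v i + t ^ 2) * (Pi.single s (1:ℝ) : B → ℝ) i = 2 * t * v s + t ^ 2 := by
    rw [Finset.sum_eq_single s]
    · simp
    · intro b _ hb; simp [Pi.single_eq_of_ne hb]
    · simp
  rw [h2]; ring

variable (M) in
/-- Perron-Frobenius type eigenvector. -/
theorem tc_perron (c : Finset B) (hc : ∀ s ∈ c, ∀ t, t ∉ c → coxEntry M s t = 0)
    (x : B → ℝ) (hxc : ∀ i, i ∉ c → x i = 0) (hx : coxForm M x x < 0) :
    ∃ (k : B → ℝ) (lam : ℝ), lam < 0 ∧ (∀ i, 0 ≤ k i) ∧ k ≠ 0 ∧ (∀ i, i ∉ c → k i = 0) ∧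
      ∀ s, coxForm M k (simpleRoot s) = lam * k s := by
  let S : Set (B → ℝ) := {y | (∀ i, i ∉ c → y i = 0) ∧ ∑ i, y i ^ 2 = 1}
  have hScl : IsClosed S := by
    refine IsClosed.inter ?_ (isClosed_eq (by fun_prop) continuous_const)
    have : {b : B → ℝ | ∀ i, i ∉ c → b i = 0} = ⋂ i, ⋂ (_ : i ∉ c), {b | b i = 0} := by
      ext b; simp
    change IsClosed {b : B → ℝ | ∀ i, i ∉ c → b i = 0}
    rw [this]
    exact isClosed_iInter fun i => isClosed_iInter fun _ =>
      isClosed_eq (continuous_apply i) continuous_const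
  have hSb : S ⊆ Metric.closedBall 0 1 := by
    rintro y ⟨_, hy⟩
    rw [mem_closedBall_zero_iff, pi_norm_le_iff_of_nonneg zero_le_one]
    intro i
    rw [Real.norm_eq_abs, abs_le_one_iff_mul_self_le_one]
    have := Finset.single_le_sum (f := fun i => y i ^ 2) (fun i _ => sq_nonneg _)
      (Finset.mem_univ i)
    nlinarith
  have hScomp : IsCompact S := (isCompact_closedBall _ _).of_isClosed_subset hScl hSb
  have hnorm : ∀ y : B → ℝ, y ≠ 0 → 0 < ∑ i, y i ^ 2 := by
    intro y hy
    obtain ⟨i, hi⟩ := Function.ne_iff.1 hy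
    exact Finset.sum_pos' (fun j _ => sq_nonneg _) ⟨i, Finset.mem_univ i, by
      have : y i ≠ 0 := hi
      positivity⟩
  have hscale : ∀ y : B → ℝ, y ≠ 0 → (∀ i, i ∉ c → y i = 0) →
      (Real.sqrt (∑ i, y i ^ 2))⁻¹ • y ∈ S := by
    intro y hy hyc
    have hp := hnorm y hy
    refine ⟨fun i hi => by simp [hyc i hi], ?_⟩
    simp only [Pi.smul_apply, smul_eq_mul, mul_pow, ← Finset.mul_sum, inv_pow]
    rw [Real.sq_sqrt hp.le]
    exact inv_mul_cancel₀ hp.ne'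
  have hqscale : ∀ y : B → ℝ, y ≠ 0 →
      coxForm M ((Real.sqrt (∑ i, y i ^ 2))⁻¹ • y) ((Real.sqrt (∑ i, y i ^ 2))⁻¹ • y) *
        (∑ i, y i ^ 2) = coxForm M y y := by
    intro y hy
    have hp := hnorm y hy
    rw [tc_smul_left, tc_smul_right]
    have h1 := Real.sq_sqrt hp.le
    have h2 : Real.sqrt (∑ i, y i ^ 2) ≠ 0 := (Real.sqrt_pos.2 hp).ne'
    rw [← mul_assoc, mul_right_comm]
    nth_rw 3 [← h1]
    field_simp
  have hx0 : x ≠ 0 := by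
    rintro rfl
    simp [coxForm] at hx
  obtain ⟨m, hmS, hmin⟩ := hScomp.exists_isMinOn ⟨_, hscale x hx0 hxc⟩
    (tc_continuous M continuous_id continuous_id).continuousOn
  set lam := coxForm M m m with hlamdef
  have hmin' : ∀ y ∈ S, lam ≤ coxForm M y y := fun y hy => hmin hy
  have hall : ∀ y : B → ℝ, (∀ i, i ∉ c → y i = 0) → lam * ∑ i, y i ^ 2 ≤ coxForm M y y := by
    intro y hyc
    by_cases hy : y = 0
    · subst hy; simp [coxForm]
    · rw [← hqscale y hy]
      exact mul_le_mul_of_nonneg_right (hmin' _ (hscale y hy hyc)) (hnorm y hy).le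
  have hlam : lam < 0 := by
    have := hall x hxc
    have h2 := hnorm x hx0
    by_contra h
    push Not at h
    have := mul_nonneg h h2.le
    linarith
  let k : B → ℝ := fun i => |m i|
  have hkc : ∀ i, i ∉ c → k i = 0 := fun i hi => by simp [k, hmS.1 i hi]
  have hk2 : ∑ i, k i ^ 2 = 1 := by simp only [k, sq_abs]; exact hmS.2
  have hkq : coxForm M k k ≤ lam := by
    rw [hlamdef]
    unfold coxForm
    refine Finset.sum_le_sum fun s _ => Finset.sum_le_sum fun t _ => ?_
    by_cases hst : s = t
    · subst hst
      simp [k]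
    · have h1 := tc_entry_nonpos M hst
      have h2 : m s * m t ≤ k s * k t := by
        simp only [k]; rw [← abs_mul]; exact le_abs_self _
      exact mul_le_mul_of_nonpos_right h2 h1
  have hk0 : k ≠ 0 := by
    intro h
    rw [h] at hk2
    simp at hk2
  refine ⟨k, lam, hlam, fun i => abs_nonneg _, hk0, hkc, fun s => ?_⟩
  by_cases hs : s ∈ c
  · have : coxForm M k (simpleRoot s) - lam * k s = 0 := by
      refine tc_quad (a := 2 - lam) (by linarith) fun t => ?_
      have h1 := hall (k + t • simpleRoot s) (fun i hi => by
        have : i ≠ s := by rintro rfl; exact hi hs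
        simp [hkc i hi, simpleRoot, Pi.single_eq_of_ne this])
      rw [tc_form_add_smul, tc_sq_add_smul, hk2] at h1
      nlinarith
    linarith
  · rw [hkc s hs, tc_symm, tc_simple_left, mul_zero]
    refine Finset.sum_eq_zero fun t _ => ?_
    by_cases ht : t ∈ c
    · rw [tc_entry_symm, hc t ht s hs, mul_zero]
    · rw [hkc t ht, zero_mul]

theorem tc_induct (hρ : ∀ (s : B) (v : B → ℝ),
      ρ (cs.simple s) v = v - coxForm M (simpleRoot s) v • simpleRoot s)
    {z : B → ℝ} (hz : ∀ v ∈ imagCone M ρ, v ≠ 0 → 0 < evalR z v) (c : Finset B) :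
    (∀ s ∈ c, ∀ t, t ∉ c → coxEntry M s t = 0) →
    ∀ v ∈ tcDual ρ, (∀ i, i ∉ c → v i = 0) → v ≠ 0 → 0 < evalR z v := by
  induction c using Finset.strongInduction with
  | H c ih =>
    intro hc v hv hvc hv0
    by_cases hpsd : ∀ x : B → ℝ, (∀ i, i ∉ c → x i = 0) → 0 ≤ coxForm M x x
    · refine hz v (subset_closure ⟨1, v, ⟨tc_dual_nonneg ρ hv, fun s => ?_⟩,
        (tc_one ρ v).symm⟩) hv0
      by_cases hs : s ∈ c
      · refine le_of_eq (tc_quad (a := 2) (by norm_num) fun t => ?_)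
        have h1 := hpsd (v + t • simpleRoot s) (fun i hi => by
          have : i ≠ s := by rintro rfl; exact hi hs
          simp [hvc i hi, simpleRoot, Pi.single_eq_of_ne this])
        rw [tc_form_add_smul] at h1
        have := tc_dual_norm cs ρ hρ hv
        linarith
      · rw [tc_symm, tc_simple_left]
        refine le_of_eq (Finset.sum_eq_zero fun t _ => ?_)
        by_cases ht : t ∈ c
        · rw [tc_entry_symm, hc t ht s hs, mul_zero]
        · rw [hvc t ht, zero_mul]
    push Not at hpsd
    obtain ⟨x, hxc, hx⟩ := hpsd
    obtain ⟨k, lam, hlam, hk0, hkne, hkc, hk⟩ := tc_perron M c hc x hxc hx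
    let J : Finset B := Finset.univ.filter fun i => k i ≠ 0
    have hkJ : ∀ i, i ∈ J ↔ k i ≠ 0 := by intro i; simp [J]
    have hJ' : ∀ s ∈ J, ∀ t, t ∉ J → coxEntry M s t = 0 := by
      intro s hs t ht
      have hkt : k t = 0 := by
        by_contra h
        exact ht ((hkJ t).2 h)
      have h1 := hk t
      rw [hkt, mul_zero, tc_symm, tc_simple_left] at h1
      have h2 := (Finset.sum_eq_zero_iff_of_nonpos (fun i _ => by
        by_cases hi : t = i
        · subst hi; rw [hkt, zero_mul]
        · exact mul_nonpos_of_nonneg_of_nonpos (hk0 i) (tc_entry_nonpos M hi))).1 h1 s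
          (Finset.mem_univ s)
      rw [tc_entry_symm]
      exact (mul_eq_zero.1 h2).resolve_left ((hkJ s).1 hs)
    have hJc : J ⊆ c := by
      intro i hi
      by_contra h
      exact (hkJ i).1 hi (hkc i h)
    have hJne : J.Nonempty := by
      obtain ⟨i, hi⟩ := Function.ne_iff.1 hkne
      exact ⟨i, (hkJ i).2 hi⟩
    have hD : ∀ s ∈ c \ J, ∀ t, t ∉ c \ J → coxEntry M s t = 0 := by
      intro s hs t ht
      rw [Finset.mem_sdiff] at hs ht
      by_cases htc : t ∈ c
      · have htJ : t ∈ J := by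
          by_contra h
          exact ht ⟨htc, h⟩
        rw [tc_entry_symm]
        exact hJ' t htJ s hs.2
      · exact hc s hs.1 t htc
    have hdec : v = tcProj J v + tcProj (c \ J) v := by
      ext i
      simp only [tcProj, Pi.add_apply, Finset.mem_sdiff]
      by_cases hi : i ∈ J
      · simp [hi]
      · by_cases hic : i ∈ c
        · simp [hi, hic]
        · simp [hi, hic, hvc i hic]
    have h1 : tcProj J v ≠ 0 → 0 < evalR z (tcProj J v) := fun hne =>
      hz _ (tc_indef cs ρ hρ J k lam hlam hk0 hkJ hk hJ' (tc_proj_dual cs ρ hρ J hJ' hv)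
        (fun i hi => by simp [tcProj, hi])) hne
    have h2 : tcProj (c \ J) v ≠ 0 → 0 < evalR z (tcProj (c \ J) v) :=
      ih (c \ J) (Finset.sdiff_ssubset hJc hJne) hD _
        (tc_proj_dual cs ρ hρ _ hD hv) (fun i hi => by
          simp only [tcProj, if_neg hi])
    have hadd : evalR z v = evalR z (tcProj J v) + evalR z (tcProj (c \ J) v) := by
      conv_lhs => rw [hdec]
      simp [evalR, add_mul, Finset.sum_add_distrib]
    have hzero : evalR z 0 = 0 := by simp [evalR]
    rw [hadd]
    by_cases ha : tcProj J v = 0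
    · by_cases hb : tcProj (c \ J) v = 0
      · exact absurd (by rw [hdec, ha, hb, add_zero]) hv0
      · rw [ha, hzero]; linarith [h2 hb]
    · by_cases hb : tcProj (c \ J) v = 0
      · rw [hb, hzero]; linarith [h1 ha]
      · linarith [h1 ha, h2 hb]

theorem tc_pos_mem (hρ : ∀ (s : B) (v : B → ℝ),
      ρ (cs.simple s) v = v - coxForm M (simpleRoot s) v • simpleRoot s)
    {z : B → ℝ} (hz : ∀ v ∈ imagCone M ρ, v ≠ 0 → 0 < evalR z v) :
    z ∈ titsConeCoord ρ := by
  by_contra hcon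
  obtain ⟨y, hy, hy0, hcl⟩ := tc_limit cs ρ hρ hcon
  have h1 := tc_induct cs ρ hρ hz Finset.univ (by simp) y hy (by simp) hy0
  have hcont : Continuous fun v => evalR z v := by unfold evalR; fun_prop
  have h2 : y ∈ {v | evalR z v ≤ 0} := by
    refine closure_minimal ?_ (isClosed_le hcont continuous_const) hcl
    rintro b ⟨c, hc, β, hβ, hneg, rfl⟩
    have : evalR z (c • β) = c * evalR z β := by
      simp [evalR, Finset.mul_sum, mul_assoc]
    change evalR z (c • β) ≤ 0
    rw [this]
    exact (mul_neg_of_pos_of_neg hc hneg).le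
  exact absurd h1 (not_lt.2 h2)

theorem tc_imag_smul {c : ℝ} (hc : 0 ≤ c) {v : B → ℝ} (hv : v ∈ imagCone M ρ) :
    c • v ∈ imagCone M ρ := by
  refine map_mem_closure (f := fun v : B → ℝ => c • v) (by fun_prop) hv ?_
  rintro _ ⟨w, k, hk, rfl⟩
  refine ⟨w, c • k, ⟨fun i => mul_nonneg hc (hk.1 i), fun s => ?_⟩, by rw [map_smul]⟩
  rw [tc_smul_left]
  exact mul_nonpos_of_nonneg_of_nonpos hc (hk.2 s)

theorem tc_open (hρ : ∀ (s : B) (v : B → ℝ),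
      ρ (cs.simple s) v = v - coxForm M (simpleRoot s) v • simpleRoot s)
    : IsOpen {z : B → ℝ | ∀ v ∈ imagCone M ρ, v ≠ 0 → 0 < evalR z v} := by
  have hcomp : IsCompact (stdSimplex ℝ B ∩ imagCone M ρ) :=
    (isCompact_stdSimplex ℝ B).inter_right isClosed_closure
  have heq : {z : B → ℝ | ∀ v ∈ imagCone M ρ, v ≠ 0 → 0 < evalR z v} =
      {z : B → ℝ | ∀ v ∈ stdSimplex ℝ B ∩ imagCone M ρ, 0 < evalR z v} := by
    ext z
    constructor
    · rintro hz v ⟨hv1, hv2⟩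
      refine hz v hv2 ?_
      rintro rfl
      have := hv1.2
      simp at this
    · intro hz v hv hv0
      have hd := tc_imag_sub_dual cs ρ hρ hv
      have hp := tc_ht_pos ρ hd hv0
      have := hz ((∑ i, v i)⁻¹ • v) ⟨⟨fun i => mul_nonneg (inv_nonneg.2 hp.le)
        (tc_dual_nonneg ρ hd i), by
          simp only [Pi.smul_apply, smul_eq_mul, ← Finset.mul_sum]
          exact inv_mul_cancel₀ hp.ne'⟩, tc_imag_smul ρ (inv_nonneg.2 hp.le) hv⟩
      have e : evalR z ((∑ i, v i)⁻¹ • v) = (∑ i, v i)⁻¹ * evalR z v := by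
        simp [evalR, Finset.mul_sum, mul_assoc]
      rw [e] at this
      exact pos_of_mul_pos_right this (inv_nonneg.2 hp.le)
  rw [heq, isOpen_iff_eventually]
  intro z hz
  refine hcomp.eventually_forall_of_forall_eventually fun v hv => ?_
  have hcont : Continuous fun p : (B → ℝ) × (B → ℝ) => evalR p.1 p.2 := by unfold evalR; fun_prop
  exact hcont.continuousAt.eventually_const_lt (hz v hv)

theorem tc_easy (hρ : ∀ (s : B) (v : B → ℝ),
      ρ (cs.simple s) v = v - coxForm M (simpleRoot s) v • simpleRoot s)
    {z : B → ℝ} (hz : z ∈ interior (titsConeCoord ρ)) {v : B → ℝ}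
    (hv : v ∈ tcDual ρ) (hv0 : v ≠ 0) : 0 < evalR z v := by
  have hT : ∀ z' ∈ titsConeCoord ρ, 0 ≤ evalR z' v := by
    rintro z' ⟨w, hw⟩
    rw [← tc_inv_apply ρ w v, tc_eval_decomp]
    exact Finset.sum_nonneg fun s _ => mul_nonneg (hv _ s) (hw s)
  have hc : Continuous fun t : ℝ => z - t • v := by fun_prop
  have h1 : ∀ᶠ t : ℝ in nhds 0, z - t • v ∈ interior (titsConeCoord ρ) := by
    refine hc.continuousAt.eventually_mem (isOpen_interior.mem_nhds ?_)
    simpa using hz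
  have h2 : ∀ᶠ t : ℝ in nhdsWithin 0 (Set.Ioi 0), z - t • v ∈ interior (titsConeCoord ρ) :=
    h1.filter_mono nhdsWithin_le_nhds
  obtain ⟨t, ht1, ht2⟩ := (h2.and self_mem_nhdsWithin).exists
  have h3 := hT _ (interior_subset ht1)
  have e : evalR (z - t • v) v = evalR z v - t * ∑ i, v i * v i := by
    simp only [evalR, Pi.sub_apply, Pi.smul_apply, smul_eq_mul, mul_sub, Finset.sum_sub_distrib,
      Finset.mul_sum]
    congr 1
    exact Finset.sum_congr rfl fun i _ => by ring
  have hpos : 0 < ∑ i, v i * v i := by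
    obtain ⟨i, hi⟩ := Function.ne_iff.1 hv0
    exact Finset.sum_pos' (fun j _ => mul_self_nonneg _)
      ⟨i, Finset.mem_univ i, mul_self_pos.2 hi⟩
  have := mul_pos (show 0 < t from ht2) hpos
  rw [e] at h3
  linarith

end TitsHelpers

/-!
STATEMENT 6: The interior of the Tits cone equals the set of linear functionals strictly
positive on all nonzero elements of the closed imaginary cone:
T° = {Z : Z(v) > 0 for all v ∈ I \ {0}}.
-/
theorem interior_titsCone_eq
    {B : Type*} [Fintype B] [DecidableEq B] (M : CoxeterMatrix B)
    {W : Type*} [Group W] (cs : CoxeterSystem M W)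
    (ρ : W →* ((B → ℝ) ≃ₗ[ℝ] (B → ℝ)))
    (hρ : ∀ (s : B) (v : B → ℝ),
      ρ (cs.simple s) v = v - coxForm M (simpleRoot s) v • simpleRoot s) :
    interior (titsConeCoord ρ) =
      {z | ∀ v ∈ imagCone M ρ, v ≠ 0 → 0 < evalR z v} := by
  apply Set.Subset.antisymm
  · intro z hz v hv hv0
    exact tc_easy cs ρ hρ hz (tc_imag_sub_dual cs ρ hρ hv) hv0
  · exact interior_maximal (fun z hz => tc_pos_mem cs ρ hρ hz) (tc_open cs ρ hρ)
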